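/- Let M, N, K be positive integers, λ > 0, and let P : Fin M → Fin N → ℝ satisfy 0 ≤ P(m, m̄') ≤ 1 for all m, m̄' and (1/N)·∑_{m̄'} P(m, m̄') ≤ λ for every m. If M·N·exp(−λ·K) < 1, then there exist permutations π₁, …, π_K of Fin N such that for every pair (m, m') ∈ Fin M × Fin N, (1/K)·∑_{ℓ=1}^{K} P(m, π_ℓ(m')) ≤ 4·λ. -/

import Mathlib

open Finset

/-- On `[0, 1]` the exponential lies below the chord bound `1 + 3 x`. -/
lemma Real.exp_le_one_add_three_mul {x : ℝ} (h0 : 0 ≤ x) (h1 : x ≤ 1) :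
    Real.exp x ≤ 1 + 3 * x := by
  have h := convexOn_exp.2 (Set.mem_univ 0) (Set.mem_univ 1) (sub_nonneg.2 h1) h0
    (sub_add_cancel 1 x)
  simp only [smul_eq_mul, mul_zero, mul_one, zero_add, Real.exp_zero] at h
  nlinarith [Real.exp_one_lt_d9]

/-- The exponential moment bound behind the Chernoff estimate for a `[0, 1]`-valued function. -/
lemma sum_exp_le_of_average_le {N : ℕ} (hN : 0 < N) {lam : ℝ} {f : Fin N → ℝ}
    (h0 : ∀ j, 0 ≤ f j) (h1 : ∀ j, f j ≤ 1) (havg : (1 / (N : ℝ)) * ∑ j, f j ≤ lam) :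
    ∑ j, Real.exp (f j) ≤ N * Real.exp (3 * lam) := by
  have hN' : (0 : ℝ) < N := by exact_mod_cast hN
  have hsum : ∑ j, f j ≤ lam * N := by
    rwa [one_div_mul_eq_div, div_le_iff₀ hN'] at havg
  calc ∑ j, Real.exp (f j) ≤ ∑ j, (1 + 3 * f j) :=
        Finset.sum_le_sum fun j _ => Real.exp_le_one_add_three_mul (h0 j) (h1 j)
    _ = N + 3 * ∑ j, f j := by simp [Finset.sum_add_distrib, Finset.mul_sum]
    _ ≤ N * (3 * lam + 1) := by linarith
    _ ≤ N * Real.exp (3 * lam) := by gcongr; exact Real.add_one_le_exp _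

/-- The exponential moment of the sum of `f` over `K` independent uniform cyclic shifts. -/
lemma sum_exp_sum_shift {N : ℕ} [NeZero N] (K : ℕ) (f : Fin N → ℝ) (j : Fin N) :
    ∑ c : Fin K → Fin N, Real.exp (∑ ℓ, f (j + c ℓ)) = (∑ i, Real.exp (f i)) ^ K := by
  rw [← Equiv.sum_comp (Equiv.addLeft j) fun i => Real.exp (f i), Fintype.sum_pow]
  simp [Real.exp_sum]

/-- Cai's derandomized permutation technique: if every semi-average error
`(1/N) ∑ mbar', P m mbar'` is at most `λ` and `M · N · exp (-λ K) < 1`, then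
there exist permutations `π 1, …, π K` of `Fin N` such that for every message
pair `(m, m')` the averaged error `(1/K) ∑ ℓ, P m (π ℓ m')` is at most `4λ`. -/
theorem exists_good_permutations (M N K : ℕ) (hM : 0 < M) (hN : 0 < N)
    (hK : 0 < K) (lam : ℝ) (hlam : 0 < lam) (P : Fin M → Fin N → ℝ)
    (hP0 : ∀ m mbar', 0 ≤ P m mbar') (hP1 : ∀ m mbar', P m mbar' ≤ 1)
    (havg : ∀ m, (1 / (N : ℝ)) * ∑ mbar', P m mbar' ≤ lam)
    (hMN : (M : ℝ) * N * Real.exp (-lam * K) < 1) :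
    ∃ π : Fin K → Equiv.Perm (Fin N), ∀ m : Fin M, ∀ m' : Fin N,
      (1 / (K : ℝ)) * ∑ ℓ, P m (π ℓ m') ≤ 4 * lam := by
  have : NeZero N := ⟨hN.ne'⟩
  have hN' : (0 : ℝ) < N := by exact_mod_cast hN
  have hK' : (0 : ℝ) < K := by exact_mod_cast hK
  suffices h : ∃ c : Fin K → Fin N, ∀ m m', ∑ ℓ, P m (m' + c ℓ) ≤ 4 * lam * K by
    obtain ⟨c, hc⟩ := h
    refine ⟨fun ℓ => Equiv.addRight (c ℓ), fun m m' => ?_⟩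
    rw [one_div_mul_eq_div, div_le_iff₀ hK']
    exact hc m m'
  by_contra! h
  have hbad (c : Fin K → Fin N) :
      1 ≤ ∑ m, ∑ m', Real.exp (∑ ℓ, P m (m' + c ℓ)) * Real.exp (-(4 * lam * K)) := by
    obtain ⟨m, m', hm⟩ := h c
    calc (1 : ℝ) ≤ Real.exp (∑ ℓ, P m (m' + c ℓ)) * Real.exp (-(4 * lam * K)) := by
          rw [← Real.exp_add]
          exact Real.one_le_exp (by linarith)
      _ ≤ ∑ m', Real.exp (∑ ℓ, P m (m' + c ℓ)) * Real.exp (-(4 * lam * K)) :=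
          Finset.single_le_sum
            (f := fun m' => Real.exp (∑ ℓ, P m (m' + c ℓ)) * Real.exp (-(4 * lam * K)))
            (fun _ _ => by positivity) (Finset.mem_univ m')
      _ ≤ _ := Finset.single_le_sum
            (f := fun m => ∑ m', Real.exp (∑ ℓ, P m (m' + c ℓ)) * Real.exp (-(4 * lam * K)))
            (fun _ _ => by positivity) (Finset.mem_univ m)
  have hcount : (N : ℝ) ^ K ≤ M * N * Real.exp (-lam * K) * N ^ K :=
    calc (N : ℝ) ^ K = ∑ c : Fin K → Fin N, (1 : ℝ) := by simp
      _ ≤ ∑ c : Fin K → Fin N, ∑ m, ∑ m',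
            Real.exp (∑ ℓ, P m (m' + c ℓ)) * Real.exp (-(4 * lam * K)) :=
          Finset.sum_le_sum fun c _ => hbad c
      _ = ∑ m, ∑ m' : Fin N, (∑ i, Real.exp (P m i)) ^ K * Real.exp (-(4 * lam * K)) := by
          rw [Finset.sum_comm]
          refine Finset.sum_congr rfl fun m _ => ?_
          rw [Finset.sum_comm]
          refine Finset.sum_congr rfl fun m' _ => ?_
          rw [← Finset.sum_mul, sum_exp_sum_shift]
      _ ≤ ∑ m : Fin M, ∑ m' : Fin N,
            (N * Real.exp (3 * lam)) ^ K * Real.exp (-(4 * lam * K)) := by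
          gcongr with m _ m' _
          exact sum_exp_le_of_average_le hN (hP0 m) (hP1 m) (havg m)
      _ = M * N * Real.exp (-lam * K) * N ^ K := by
          have hexp : Real.exp (-lam * K) =
              Real.exp (3 * lam) ^ K * Real.exp (-(4 * lam * K)) := by
            rw [← Real.exp_nat_mul, ← Real.exp_add]
            ring_nf
          simp only [Finset.sum_const, Finset.card_univ, Fintype.card_fin, nsmul_eq_mul, hexp]
          ring
  exact absurd hcount (not_le.2 (mul_lt_of_lt_one_left (by positivity) hMN))
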